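/- Let C_0 ≥ 0. Suppose the hyperplanes in 𝒜 are pairwise non-parallel and ‖F(A)‖ > C_0 for every A ∈ 𝒜. Then for every k with 1 ≤ k ≤ n, E_{k−1} ≤ (1/|S_k|²) · ∑_{F_1, F_2 ⊆ {1,…,k−1}, ‖F_1‖ > C_0/|S_k|, ‖F_2‖ > C_0/|S_k|} ∏_{j ∈ F_1 ∪ F_2} 1/((1−δ_j)|S_j|). -/

import Mathlib

open Finset
open scoped Classical

/-- A hyperplane in `S_1 × ⋯ × S_n`.  Coordinates are 0-indexed in Lean:
coordinate `j : ℕ`, `j < n`, corresponds to the paper's coordinate `j + 1`,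
so the paper's set `S_j` is `S (j - 1)` here.  A hyperplane is recorded by its
finite set `F` of fixed coordinates together with the fixed value at each
fixed coordinate (on the non-fixed coordinates it is all of `S j`). -/
structure Hyp (S : ℕ → Type) (n : ℕ) where
  F : Finset ℕ
  hF : ∀ j ∈ F, j < n
  val : ∀ j ∈ F, S j

/-- The stage of a hyperplane: in the paper's 1-based labelling,
`A.stage = max F(A)`; in the 0-based labelling it is `(sup of A.F) + 1`. -/
def Hyp.stage {S : ℕ → Type} {n : ℕ} (A : Hyp S n) : ℕ := A.F.sup id + 1

/-- `Qp S k` is the paper's `Q_k = S_1 × ⋯ × S_k` (in 0-based indexing,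
`S 0 × ⋯ × S (k-1)`).  `Qp S 0` is a one-element type. -/
abbrev Qp (S : ℕ → Type) (k : ℕ) := ∀ j : Fin k, S j

/-- `x ∈ Q_k` lies on (the projection to `Q_k` of) the hyperplane `A`;
this is the correct notion of membership whenever `F(A) ⊆ {1, …, k}`. -/
def memH {S : ℕ → Type} {n : ℕ} (A : Hyp S n) {k : ℕ} (x : Qp S k) : Prop :=
  ∀ (j : Fin k) (h : (j : ℕ) ∈ A.F), x j = A.val j h

/-- Membership in `B_k = ⋃_{A ∈ 𝒜_k} A`, viewed as a subset of `Q_k`, where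
`𝒜_k = {A ∈ 𝒜 : max F(A) = k}` (1-based `k`). -/
def memB {S : ℕ → Type} {n : ℕ} {ι : Type} (𝓐 : ι → Hyp S n) (k : ℕ) (x : Qp S k) : Prop :=
  ∃ i, (𝓐 i).stage = k ∧ memH (𝓐 i) x

/-- `alpha 𝓐 k x` is the paper's `α_{k+1}(x)` for `x ∈ Q_k`: the proportion of
the fiber `F_x` covered by `B_{k+1}`. -/
noncomputable def alpha {S : ℕ → Type} [∀ j, Fintype (S j)] {n : ℕ} {ι : Type}
    (𝓐 : ι → Hyp S n) (k : ℕ) (x : Qp S k) : ℝ :=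
  ((univ.filter fun y : S k => memB 𝓐 (k + 1) (Fin.snoc x y)).card : ℝ) /
    (Fintype.card (S k))

/-- The weights `w_k : Q_k → ℝ`, defined inductively:  `w_0 ≡ 1`, and `w_(k+1)`
is obtained from `w_k` by the distortion rule with parameter `δ_{k+1} = δ k`.
(The paper's `δ_j` is `δ (j - 1)` here.) -/
noncomputable def w {S : ℕ → Type} [∀ j, Fintype (S j)] {n : ℕ} {ι : Type}
    (𝓐 : ι → Hyp S n) (δ : ℕ → ℝ) : (k : ℕ) → Qp S k → ℝ
  | 0, _ => 1
  | (k + 1), x =>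
      let x' : Qp S k := fun j => x j.castSucc
      let a : ℝ := alpha 𝓐 k x'
      if memB 𝓐 (k + 1) x then
        if a ≤ δ k then 0
        else ((a - δ k) / (a * (1 - δ k))) * (w 𝓐 δ k x' / (Fintype.card (S k)))
      else
        if a ≤ δ k then (1 / (1 - a)) * (w 𝓐 δ k x' / (Fintype.card (S k)))
        else (1 / (1 - δ k)) * (w 𝓐 δ k x' / (Fintype.card (S k)))

/-- `w_k(B_k)` (1-based `k`). -/
noncomputable def wB {S : ℕ → Type} [∀ j, Fintype (S j)] {n : ℕ} {ι : Type}
    (𝓐 : ι → Hyp S n) (δ : ℕ → ℝ) (k : ℕ) : ℝ :=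
  ∑ x ∈ univ.filter (memB 𝓐 k), w 𝓐 δ k x

/-- `w_k(A)`: the weight of the projection to `Q_k` of a hyperplane `A`
(meaningful when `F(A) ⊆ {1, …, k}`). -/
noncomputable def wH {S : ℕ → Type} [∀ j, Fintype (S j)] {n : ℕ} {ι : Type}
    (𝓐 : ι → Hyp S n) (δ : ℕ → ℝ) (k : ℕ) (A : Hyp S n) : ℝ :=
  ∑ x ∈ univ.filter (fun x : Qp S k => memH A x), w 𝓐 δ k x

/-- `ν(J) = ∏_{j ∈ J} 1 / ((1 - δ_j)|S_j|)` (0-based `J`). -/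
noncomputable def nu (S : ℕ → Type) [∀ j, Fintype (S j)] (δ : ℕ → ℝ) (J : Finset ℕ) : ℝ :=
  ∏ j ∈ J, 1 / ((1 - δ j) * (Fintype.card (S j)))

/-- `‖J‖ = ∏_{j ∈ J} |S_j|` (0-based `J`). -/
noncomputable def normJ (S : ℕ → Type) [∀ j, Fintype (S j)] (J : Finset ℕ) : ℝ :=
  ∏ j ∈ J, (Fintype.card (S j) : ℝ)

/-- `Ew 𝓐 δ k` is the paper's `E_k = E_{(k+1)-1} = ∑_{x ∈ Q_k} α_{k+1}(x)² w_k(x)`. -/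
noncomputable def Ew {S : ℕ → Type} [∀ j, Fintype (S j)] {n : ℕ} {ι : Type}
    (𝓐 : ι → Hyp S n) (δ : ℕ → ℝ) (k : ℕ) : ℝ :=
  ∑ x : Qp S k, (alpha 𝓐 k x) ^ 2 * w 𝓐 δ k x

lemma Hyp.lt_stage {S : ℕ → Type} {n : ℕ} {A : Hyp S n} {j : ℕ} (hj : j ∈ A.F) : j < A.stage :=
  Nat.lt_succ_of_le (le_sup (f := id) hj)

lemma Hyp.mem_of_stage_eq {S : ℕ → Type} {n : ℕ} {A : Hyp S n}
    (hA : A.F.Nonempty) {k : ℕ} (hk : A.stage = k + 1) :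
    k ∈ A.F := by
  obtain ⟨j, hj, hj'⟩ := exists_mem_eq_sup A.F hA id
  have : A.F.sup id = k := Nat.succ_injective hk
  rw [← this, hj']
  exact hj

section Weights

variable {S : ℕ → Type} [∀ j, Fintype (S j)] {n : ℕ} {ι : Type} {𝓐 : ι → Hyp S n} {δ : ℕ → ℝ}

lemma alpha_nonneg (𝓐 : ι → Hyp S n) (k : ℕ) (x : Qp S k) : 0 ≤ alpha 𝓐 k x := by
  unfold alpha; positivity

lemma alpha_le_one (𝓐 : ι → Hyp S n) (k : ℕ) (x : Qp S k) : alpha 𝓐 k x ≤ 1 :=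
  div_le_one_of_le₀ (by exact_mod_cast card_filter_le _ _) (by positivity)

/-- The distortion rule for the weight of a point of the fibre over `x`. -/
lemma w_snoc (k : ℕ) (x : Qp S k) (y : S k) :
    w 𝓐 δ (k + 1) (Fin.snoc x y) =
      if memB 𝓐 (k + 1) (Fin.snoc x y) then
        if alpha 𝓐 k x ≤ δ k then 0
        else ((alpha 𝓐 k x - δ k) / (alpha 𝓐 k x * (1 - δ k))) *
          (w 𝓐 δ k x / (Fintype.card (S k)))
      else
        if alpha 𝓐 k x ≤ δ k then (1 / (1 - alpha 𝓐 k x)) * (w 𝓐 δ k x / (Fintype.card (S k)))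
        else (1 / (1 - δ k)) * (w 𝓐 δ k x / (Fintype.card (S k))) := by
  have h : (fun j : Fin k => (Fin.snoc x y : Qp S (k + 1)) j.castSucc) = x := by
    funext j
    exact Fin.snoc_castSucc (α := fun j : Fin (k + 1) => S j) y x j
  rw [w]
  simp only [h]

lemma w_nonneg {k : ℕ} (hδ : ∀ j < k, δ j < 1) (x : Qp S k) : 0 ≤ w 𝓐 δ k x := by
  induction k with
  | zero => simp [w]
  | succ k ih =>
    have hw := ih (fun j hj => hδ j (by omega)) (fun j => x j.castSucc)
    have hd := hδ k (by omega)
    have h0 := alpha_nonneg 𝓐 k (fun j => x j.castSucc)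
    have h1 := alpha_le_one 𝓐 k (fun j => x j.castSucc)
    have hd' : 0 ≤ 1 - δ k := by linarith
    have h1' : 0 ≤ 1 - alpha 𝓐 k (fun j => x j.castSucc) := by linarith
    rw [w]
    split_ifs with hB ha ha
    · exact le_rfl
    · have : 0 ≤ alpha 𝓐 k (fun j => x j.castSucc) - δ k := by linarith
      positivity
    · positivity
    · positivity

lemma w_snoc_le {k : ℕ} (hδ : ∀ j < k, δ j < 1) (hδ0 : 0 ≤ δ k) (hδ1 : δ k < 1)
    (x : Qp S k) (y : S k) :
    w 𝓐 δ (k + 1) (Fin.snoc x y) ≤ 1 / ((1 - δ k) * Fintype.card (S k)) * w 𝓐 δ k x := by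
  have hw := w_nonneg (𝓐 := 𝓐) hδ x
  have h0 := alpha_nonneg 𝓐 k x
  have hd : 0 < 1 - δ k := by linarith
  have hrhs : 1 / ((1 - δ k) * Fintype.card (S k)) * w 𝓐 δ k x =
      (1 / (1 - δ k)) * (w 𝓐 δ k x / Fintype.card (S k)) := by
    rw [one_div_mul_eq_div, one_div_mul_eq_div, div_div, mul_comm]
  rw [hrhs, w_snoc]
  split_ifs with hB ha ha
  · positivity
  · push Not at ha
    have hpos : 0 < alpha 𝓐 k x := hδ0.trans_lt ha
    refine mul_le_mul_of_nonneg_right ?_ (by positivity)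
    rw [div_le_div_iff₀ (by positivity) hd]
    nlinarith [mul_nonneg hd.le hδ0]
  · gcongr
  · exact le_rfl

/-- Distortion does not change the total weight of a fibre. -/
lemma sum_w_snoc {k : ℕ} [Nonempty (S k)] (hδ0 : 0 ≤ δ k) (hδ1 : δ k < 1) (x : Qp S k) :
    ∑ y : S k, w 𝓐 δ (k + 1) (Fin.snoc x y) = w 𝓐 δ k x := by
  have hN : (0 : ℝ) < Fintype.card (S k) := by exact_mod_cast Fintype.card_pos
  have hin : ((univ.filter fun y : S k => memB 𝓐 (k + 1) (Fin.snoc x y)).card : ℝ) =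
      alpha 𝓐 k x * Fintype.card (S k) := by
    rw [alpha, div_mul_cancel₀ _ hN.ne']
  have hout : ((univ.filter fun y : S k => ¬ memB 𝓐 (k + 1) (Fin.snoc x y)).card : ℝ) =
      (1 - alpha 𝓐 k x) * Fintype.card (S k) := by
    have h := card_filter_add_card_filter_not (s := (univ : Finset (S k)))
      (fun y : S k => memB 𝓐 (k + 1) (Fin.snoc x y))
    have h' : ((univ.filter fun y : S k => memB 𝓐 (k + 1) (Fin.snoc x y)).card : ℝ) +
      ((univ.filter fun y : S k => ¬ memB 𝓐 (k + 1) (Fin.snoc x y)).card : ℝ) =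
        Fintype.card (S k) := by exact_mod_cast h
    linarith
  have hd : 1 - δ k ≠ 0 := by linarith
  simp_rw [w_snoc]
  rw [sum_ite, sum_const, sum_const, nsmul_eq_mul, nsmul_eq_mul, hin, hout]
  split_ifs with ha
  · have : 1 - alpha 𝓐 k x ≠ 0 := by linarith
    field_simp
    ring
  · have : alpha 𝓐 k x ≠ 0 := by linarith
    field_simp
    ring

lemma sum_snoc {k : ℕ} (f : Qp S (k + 1) → ℝ) :
    ∑ x, f x = ∑ x : Qp S k, ∑ y : S k, f (Fin.snoc x y) := by
  rw [← Equiv.sum_comp (Fin.snocEquiv (fun j : Fin (k + 1) => S j)) f,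
    Fintype.sum_prod_type_right]
  rfl

/-- A hyperplane with set of fixed coordinates `J` has weight at most `ν(J)`. -/
lemma sum_w_le_nu {k : ℕ} (hne : ∀ j < k, Nonempty (S j)) (hδ0 : ∀ j < k, 0 ≤ δ j)
    (hδ1 : ∀ j < k, δ j < 1) {J : Finset ℕ} (hJ : J ⊆ range k) (z : Qp S k) :
    (∑ x : Qp S k, if ∀ j : Fin k, (j : ℕ) ∈ J → x j = z j then w 𝓐 δ k x else 0) ≤
      nu S δ J := by
  induction k generalizing J with
  | zero =>
    obtain rfl : J = ∅ := by simpa using hJ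
    simp [w, nu]
  | succ k ih =>
    have hδ1' : ∀ j < k, δ j < 1 := fun j hj => hδ1 j (by omega)
    have hd : 0 < 1 - δ k := sub_pos.2 (hδ1 k (by omega))
    have := hne k (by omega)
    have ih' := ih (fun j hj => hne j (by omega)) (fun j hj => hδ0 j (by omega)) hδ1'
      (J := J.erase k) (fun j hj => by
        have h1 := mem_range.1 (hJ (mem_of_mem_erase hj))
        have h2 := ne_of_mem_erase hj
        exact mem_range.2 (by omega)) (fun j => z j.castSucc)
    have hiff (x : Qp S k) (y : S k) :
        (∀ j : Fin (k + 1), (j : ℕ) ∈ J → (Fin.snoc x y : Qp S (k + 1)) j = z j) ↔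
          (∀ j : Fin k, (j : ℕ) ∈ J.erase k → x j = z j.castSucc) ∧
            (k ∈ J → y = z (Fin.last k)) := by
      rw [Fin.forall_fin_succ']
      refine and_congr (forall_congr' fun j => ?_) ?_
      · have hs := Fin.snoc_castSucc (α := fun j : Fin (k + 1) => S j) y x j
        rw [hs, mem_erase]
        simp [j.isLt.ne]
      · have hs := Fin.snoc_last (α := fun j : Fin (k + 1) => S j) y x
        rw [hs]
        simp
    set c : ℝ := if k ∈ J then 1 / ((1 - δ k) * Fintype.card (S k)) else 1 with hc
    have hc0 : 0 ≤ c := by rw [hc]; split_ifs <;> positivity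
    have hnu : nu S δ J = c * nu S δ (J.erase k) := by
      rw [hc]
      split_ifs with h
      · exact (mul_prod_erase J _ h).symm
      · rw [erase_eq_of_notMem h, one_mul]
    rw [sum_snoc, hnu]
    refine le_trans ?_ (mul_le_mul_of_nonneg_left ih' hc0)
    rw [mul_sum]
    refine sum_le_sum fun x _ => ?_
    simp_rw [hiff, ite_and]
    split_ifs with hx
    · rw [hc]
      split_ifs with h
      · simp only [h, true_imp_iff]
        refine (Fintype.sum_eq_single (z (Fin.last k)) fun y hy => if_neg hy).trans_le ?_
        rw [if_pos rfl]
        exact w_snoc_le hδ1' (hδ0 k (by omega)) (hδ1 k (by omega)) x (z (Fin.last k))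
      · simp only [h, false_imp_iff, if_true, one_mul]
        exact (sum_w_snoc (hδ0 k (by omega)) (hδ1 k (by omega)) x).le
    · simp

lemma nu_nonneg {J : Finset ℕ} (hδ : ∀ j ∈ J, δ j < 1) : 0 ≤ nu S δ J := by
  refine prod_nonneg fun j hj => ?_
  have : 0 < 1 - δ j := sub_pos.2 (hδ j hj)
  positivity

/-- Union bound: each hyperplane of stage `k + 1` meets a fibre in at most one point. -/
lemma alpha_le_sum [Fintype ι] (hFne : ∀ i, (𝓐 i).F.Nonempty) (k : ℕ) (x : Qp S k) :
    alpha 𝓐 k x ≤ 1 / (Fintype.card (S k) : ℝ) *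
      ∑ i with (𝓐 i).stage = k + 1, if memH (𝓐 i) x then (1 : ℝ) else 0 := by
  rw [alpha, one_div_mul_eq_div]
  gcongr
  rw [sum_boole, filter_filter]
  norm_cast
  refine card_le_card_of_forall_subsingleton
    (fun y i => ∀ h : k ∈ (𝓐 i).F, y = (𝓐 i).val k h) (fun y hy => ?_) fun i hi y hy y' hy' => ?_
  · obtain ⟨i, hi, hm⟩ := (mem_filter.1 hy).2
    refine ⟨i, mem_filter.2 ⟨mem_univ _, hi, fun j hj => ?_⟩, fun h => ?_⟩
    · rw [← Fin.snoc_castSucc (α := fun j : Fin (k + 1) => S j) y x j]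
      exact hm j.castSucc hj
    · rw [← Fin.snoc_last (α := fun j : Fin (k + 1) => S j) y x]
      exact hm (Fin.last k) h
  · have hk := (𝓐 i).mem_of_stage_eq (hFne i) (mem_filter.1 hi).2.1
    rw [hy.2 hk, hy'.2 hk]

lemma sum_memH_memH_le {k : ℕ} (hne : ∀ j < k, Nonempty (S j)) (hδ0 : ∀ j < k, 0 ≤ δ j)
    (hδ1 : ∀ j < k, δ j < 1) {A A' : Hyp S n} (hA : A.stage = k + 1) (hA' : A'.stage = k + 1) :
    (∑ x : Qp S k, (if memH A x then (1 : ℝ) else 0) * (if memH A' x then 1 else 0) * w 𝓐 δ k x) ≤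
      nu S δ (A.F.erase k ∪ A'.F.erase k) := by
  have hsub {A : Hyp S n} (hA : A.stage = k + 1) : A.F.erase k ⊆ range k := fun j hj => by
    have h1 := A.lt_stage (mem_of_mem_erase hj)
    have h2 := ne_of_mem_erase hj
    exact mem_range.2 (by omega)
  have hJ := union_subset (hsub hA) (hsub hA')
  by_cases hz : ∃ z : Qp S k, memH A z ∧ memH A' z
  · obtain ⟨z, hz, hz'⟩ := hz
    refine le_trans (sum_le_sum fun x _ => ?_) (sum_w_le_nu (𝓐 := 𝓐) hne hδ0 hδ1 hJ z)
    have hw := w_nonneg (𝓐 := 𝓐) hδ1 x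
    by_cases hx : memH A x ∧ memH A' x
    · rw [if_pos hx.1, if_pos hx.2, if_pos]
      · simp
      · intro j hj
        rcases mem_union.1 hj with h | h
        · rw [hx.1 j (mem_of_mem_erase h), hz j (mem_of_mem_erase h)]
        · rw [hx.2 j (mem_of_mem_erase h), hz' j (mem_of_mem_erase h)]
    · refine le_of_eq_of_le ?_ (ite_nonneg hw le_rfl)
      split_ifs <;> simp_all
  · refine le_trans (le_of_eq (sum_eq_zero fun x _ => ?_))
      (nu_nonneg fun j hj => hδ1 j (mem_range.1 (hJ hj)))
    have hx : ¬(memH A x ∧ memH A' x) := fun h => hz ⟨x, h⟩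
    split_ifs <;> simp_all

end Weights

/-- **Lemma 5.**  Let `C₀ ≥ 0`.  If the hyperplanes of `𝒜` are pairwise
non-parallel and `‖F(A)‖ > C₀` for every `A ∈ 𝒜`, then for `1 ≤ k ≤ n`
(the paper's `k` is `k + 1` here, `k < n`):
`E_{k-1} ≤ (1/|S_k|²) ∑_{F₁,F₂ ⊆ {1,…,k-1}, ‖F₁‖ > C₀/|S_k|, ‖F₂‖ > C₀/|S_k|}
  ∏_{j ∈ F₁ ∪ F₂} 1 / ((1 - δ_j)|S_j|)`. -/
theorem E_le_double_sum
    (S : ℕ → Type) [∀ j, Fintype (S j)] (n : ℕ) (hn : 0 < n)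
    (hcard : ∀ j, j < n → 2 ≤ Fintype.card (S j))
    (δ : ℕ → ℝ) (hδ : ∀ j, j < n → δ j ∈ Set.Icc (0 : ℝ) (1 / 2))
    (ι : Type) [Fintype ι] (𝓐 : ι → Hyp S n)
    (hFne : ∀ i, (𝓐 i).F.Nonempty)
    (hpar : ∀ i i', (𝓐 i).F = (𝓐 i').F → i = i')
    (C₀ : ℝ) (hC₀ : 0 ≤ C₀)
    (hnorm : ∀ i, C₀ < normJ S (𝓐 i).F)
    (k : ℕ) (hk : k < n) :
    Ew 𝓐 δ k ≤ (1 / (Fintype.card (S k) : ℝ) ^ 2) *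
      ∑ F₁ ∈ (Finset.range k).powerset.filter
          (fun J => C₀ / (Fintype.card (S k)) < normJ S J),
        ∑ F₂ ∈ (Finset.range k).powerset.filter
            (fun J => C₀ / (Fintype.card (S k)) < normJ S J),
          ∏ j ∈ F₁ ∪ F₂, 1 / ((1 - δ j) * (Fintype.card (S j))) := by
  have hN : (0 : ℝ) < Fintype.card (S k) := by
    have := hcard k hk
    exact_mod_cast (by omega : 0 < Fintype.card (S k))
  have hne (j : ℕ) (hj : j < k) : Nonempty (S j) := by
    have := hcard j (hj.trans hk)
    exact Fintype.card_pos_iff.1 (by omega)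
  have hδ0 (j : ℕ) (hj : j < k) : 0 ≤ δ j := (hδ j (hj.trans hk)).1
  have hδ1 (j : ℕ) (hj : j < k) : δ j < 1 := by linarith [(hδ j (hj.trans hk)).2]
  set P := (Finset.range k).powerset.filter (fun J => C₀ / (Fintype.card (S k)) < normJ S J)
    with hP
  set T : Finset ι := univ.filter fun i => (𝓐 i).stage = k + 1 with hT
  have hmem (i : ι) (hi : i ∈ T) : k ∈ (𝓐 i).F :=
    (𝓐 i).mem_of_stage_eq (hFne i) (mem_filter.1 hi).2
  have hinj : Set.InjOn (fun i => (𝓐 i).F.erase k) T := fun i hi i' hi' h => by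
    apply hpar
    rw [← insert_erase (hmem i hi), ← insert_erase (hmem i' hi')]
    exact congrArg (insert k) h
  have himage : T.image (fun i => (𝓐 i).F.erase k) ⊆ P := by
    intro J hJ
    obtain ⟨i, hi, rfl⟩ := mem_image.1 hJ
    refine mem_filter.2 ⟨mem_powerset.2 fun j hj => ?_, ?_⟩
    · have h1 := (𝓐 i).lt_stage (mem_of_mem_erase hj)
      have h2 := ne_of_mem_erase hj
      have h3 := (mem_filter.1 hi).2
      exact mem_range.2 (by omega)
    · rw [div_lt_iff₀ hN, normJ, prod_erase_mul _ _ (hmem i hi)]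
      exact hnorm i
  have hnn (F₁ F₂ : Finset ℕ) (h₁ : F₁ ∈ P) (h₂ : F₂ ∈ P) : 0 ≤ nu S δ (F₁ ∪ F₂) :=
    nu_nonneg fun j hj => hδ1 j <| mem_range.1 <|
      union_subset (mem_powerset.1 (mem_filter.1 h₁).1) (mem_powerset.1 (mem_filter.1 h₂).1) hj
  calc Ew 𝓐 δ k
      ≤ ∑ x : Qp S k, (1 / (Fintype.card (S k) : ℝ) *
          ∑ i ∈ T, if memH (𝓐 i) x then (1 : ℝ) else 0) ^ 2 * w 𝓐 δ k x := by
        refine sum_le_sum fun x _ => mul_le_mul_of_nonneg_right ?_ (w_nonneg hδ1 x)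
        exact pow_le_pow_left₀ (alpha_nonneg 𝓐 k x) (alpha_le_sum hFne k x) 2
    _ = 1 / (Fintype.card (S k) : ℝ) ^ 2 * ∑ i ∈ T, ∑ i' ∈ T, ∑ x : Qp S k,
          (if memH (𝓐 i) x then (1 : ℝ) else 0) * (if memH (𝓐 i') x then 1 else 0) *
            w 𝓐 δ k x := by
        simp_rw [mul_pow, one_div, inv_pow, mul_assoc, ← mul_sum, sq (∑ i ∈ T, _), sum_mul_sum,
          sum_mul, mul_assoc]
        rw [sum_comm]
        congr 1
        exact sum_congr rfl fun i _ => sum_comm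
    _ ≤ 1 / (Fintype.card (S k) : ℝ) ^ 2 * ∑ i ∈ T, ∑ i' ∈ T,
          nu S δ ((𝓐 i).F.erase k ∪ (𝓐 i').F.erase k) := by
        gcongr with i hi i' hi'
        exact sum_memH_memH_le hne hδ0 hδ1 (mem_filter.1 hi).2 (mem_filter.1 hi').2
    _ = 1 / (Fintype.card (S k) : ℝ) ^ 2 * ∑ F₁ ∈ T.image (fun i => (𝓐 i).F.erase k),
          ∑ F₂ ∈ T.image (fun i => (𝓐 i).F.erase k), nu S δ (F₁ ∪ F₂) := by
        rw [sum_image hinj]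
        simp_rw [sum_image hinj]
    _ ≤ 1 / (Fintype.card (S k) : ℝ) ^ 2 * ∑ F₁ ∈ P, ∑ F₂ ∈ P, nu S δ (F₁ ∪ F₂) := by
        gcongr
        calc _ ≤ ∑ F₁ ∈ T.image (fun i => (𝓐 i).F.erase k), ∑ F₂ ∈ P, nu S δ (F₁ ∪ F₂) :=
              sum_le_sum fun F₁ h₁ => sum_le_sum_of_subset_of_nonneg himage
                fun F₂ h₂ _ => hnn F₁ F₂ (himage h₁) h₂
          _ ≤ _ := sum_le_sum_of_subset_of_nonneg himage
                fun F₁ h₁ _ => sum_nonneg fun F₂ h₂ => hnn F₁ F₂ h₁ h₂
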